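/- Let n be a nonnegative integer and let a, b, c ∈ ℂ satisfy a + (b−1)n ≠ 0, 1+c−bn+j ≠ 0 for 0 ≤ j ≤ n−1 and for 0 ≤ j ≤ ⌊n/2⌋, and (b−1)n−c+j ≠ 0 for 0 ≤ j ≤ ⌊n/2⌋. Then (a/(a+(b−1)n)) · (1−a−bn)_n/((1+c−bn)_n) = Σ_{k=0}^{⌊n/2⌋} C(n,2k) (c+1+k−2bk) (a+c+1)_k (−a−c)_k / (((b−1)n−c)_k (1+c−bn)_{k+1}) + Σ_{0 ≤ 2k+1 ≤ n} C(n,2k+1) (c+1+k−(2k+1)b) (a+c+1)_{k+1} (−a−c)_k / (((b−1)n−c)_{k+1} (1+c−bn)_{k+1}). (First-type reciprocal relation obtained from the Hagen–Rothe convolution identity by duplicate inversion.) -/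

import Mathlib

/-- Rising factorial (Pochhammer symbol) of a complex number:
`poch x 0 = 1` and `poch x (m+1) = poch x m * (x + m)`. -/
noncomputable def poch (x : ℂ) : ℕ → ℂ
  | 0 => 1
  | m + 1 => poch x m * (x + (m : ℂ))

theorem poch_succ_left (x : ℂ) (k : ℕ) : poch x (k + 1) = x * poch (x + 1) k := by
  induction k with
  | zero => simp [poch]
  | succ k ih =>
    rw [poch, ih, poch]
    push_cast
    ring

theorem poch_ne (x : ℂ) (k : ℕ) (h : ∀ i : ℕ, i < k → x + (i : ℂ) ≠ 0) : poch x k ≠ 0 := by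
  induction k with
  | zero => simp [poch]
  | succ k ih =>
    rw [poch]
    exact mul_ne_zero (ih fun i hi => h i (by omega)) (h k (by omega))

/-- Newton-type basis. -/
noncomputable def EE (x : ℂ) (j : ℕ) : ℂ := poch (x + 1) ((j + 1) / 2) * poch (-x) (j / 2)

/-- Denominators. -/
noncomputable def DD (y : ℂ) (m : ℕ) (j : ℕ) : ℂ :=
  poch (-y - m - 1) ((j + 1) / 2) * poch (1 + y) (j / 2 + 1)

theorem EE_even (x : ℂ) (k : ℕ) : EE x (2 * k) = poch (x + 1) k * poch (-x) k := by
  unfold EE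
  rw [show (2 * k + 1) / 2 = k by omega, show 2 * k / 2 = k by omega]

theorem EE_odd (x : ℂ) (k : ℕ) : EE x (2 * k + 1) = poch (x + 1) (k + 1) * poch (-x) k := by
  unfold EE
  rw [show (2 * k + 1 + 1) / 2 = k + 1 by omega, show (2 * k + 1) / 2 = k by omega]

theorem DD_even (y : ℂ) (m k : ℕ) :
    DD y m (2 * k) = poch (-y - m - 1) k * poch (1 + y) (k + 1) := by
  unfold DD
  rw [show (2 * k + 1) / 2 = k by omega, show 2 * k / 2 = k by omega]

theorem DD_odd (y : ℂ) (m k : ℕ) :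
    DD y m (2 * k + 1) = poch (-y - m - 1) (k + 1) * poch (1 + y) (k + 1) := by
  unfold DD
  rw [show (2 * k + 1 + 1) / 2 = k + 1 by omega, show (2 * k + 1) / 2 = k by omega]

theorem choose_rel (m j : ℕ) :
    ((j : ℂ) + 1) * (m.choose (j + 1) : ℂ) = ((m : ℂ) - j) * (m.choose j : ℂ) := by
  rcases le_or_gt j m with h | h
  · have := Nat.choose_succ_right_eq m j
    have h2 : ((m.choose (j + 1) * (j + 1) : ℕ) : ℂ) = ((m.choose j * (m - j) : ℕ) : ℂ) := by
      rw [this]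
    push_cast [Nat.cast_sub h] at h2
    linear_combination h2
  · rw [Nat.choose_eq_zero_of_lt h, Nat.choose_eq_zero_of_lt (by omega : m < j + 1)]
    simp

theorem choose_pascal (m j : ℕ) :
    ((m + 1).choose (j + 1) : ℂ) = (m.choose j : ℂ) + (m.choose (j + 1) : ℂ) := by
  rw [Nat.choose_succ_succ]; push_cast; ring

/-- Sign of the shift: `x * E_j` contributes with sign depending on parity. -/
noncomputable def HH (x y : ℂ) (m : ℕ) : ℕ → ℂ
  | 0 => 0
  | j + 1 => (-1) ^ (j + 1) * (m.choose j : ℂ) * EE x (j + 1) / DD y m j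

theorem tele (m : ℕ) (t r h : ℕ → ℂ) (s : ℂ) (ht : t (m + 1) = 0) (h0 : h 0 = 0)
    (h1 : h (m + 2) = 0)
    (H : ∀ j, j < m + 2 → s * t j = r j - h j + h (j + 1)) :
    s * ∑ j ∈ Finset.range (m + 1), t j = ∑ j ∈ Finset.range (m + 2), r j := by
  have e : ∑ j ∈ Finset.range (m + 1), t j = ∑ j ∈ Finset.range (m + 2), t j := by
    rw [Finset.sum_range_succ t (m + 1), ht, add_zero]
  rw [e, Finset.mul_sum, Finset.sum_congr rfl (fun j hj => H j (Finset.mem_range.mp hj))]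
  have := Finset.sum_range_sub h (m + 2)
  rw [h0, h1] at this
  have e2 : ∀ j, r j - h j + h (j + 1) = r j + (h (j + 1) - h j) := fun j => by ring
  simp only [e2, Finset.sum_add_distrib, this]
  ring

theorem HH_last (x y : ℂ) (m : ℕ) : HH x y m (m + 2) = 0 := by
  simp [HH]

theorem ynz {y : ℂ} {m : ℕ} (h : ∀ i : ℕ, i < m → 1 + y + (i : ℂ) ≠ 0) (i : ℕ) (hi : i < m) :
    -y - m + (i : ℂ) ≠ 0 := by
  have := h (m - 1 - i) (by omega)
  rw [Nat.cast_sub (by omega), Nat.cast_sub (by omega)] at this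
  intro h2
  apply this
  push_cast
  linear_combination -h2

theorem parity_cases (j : ℕ) : j = 0 ∨ (∃ k, j = 2 * k + 1) ∨ (∃ k, j = 2 * (k + 1)) := by
  rcases Nat.even_or_odd' j with ⟨k, rfl | rfl⟩
  · rcases k with _ | k
    · left; rfl
    · right; right; exact ⟨k, rfl⟩
  · right; left; exact ⟨k, rfl⟩

theorem HH_odd (x y : ℂ) (m k : ℕ) : HH x y m (2 * k + 1) =
    - (m.choose (2 * k) : ℂ) * EE x (2 * k + 1) / DD y m (2 * k) := by
  simp [HH, pow_succ, pow_mul]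

theorem HH_even (x y : ℂ) (m k : ℕ) : HH x y m (2 * (k + 1)) =
    (m.choose (2 * k + 1) : ℂ) * EE x (2 * (k + 1)) / DD y m (2 * k + 1) := by
  rw [show 2 * (k + 1) = (2 * k + 1) + 1 by ring]
  simp [HH, pow_succ, pow_mul]

theorem step_one (x y : ℂ) (m : ℕ) (h : ∀ i : ℕ, i < m + 2 → 1 + y + (i : ℂ) ≠ 0) (j : ℕ)
    (hj : j < m + 2) :
    (m + 1 + y - x) * ((m.choose j : ℂ) * EE x j / DD y m j) =
      (y + m + 2) * (((m + 1).choose j : ℂ) * EE x j / DD y (m + 1) j)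
        - HH x y m j + HH x y m (j + 1) := by
  have hn := ynz h
  rcases parity_cases j with rfl | ⟨k, rfl⟩ | ⟨k, rfl⟩
  · have := h 0 (by omega)
    simp [HH, EE, DD, poch] at this ⊢
    field_simp
    ring
  · rw [show 2 * k + 1 + 1 = 2 * (k + 1) by ring, HH_odd, HH_even, EE_odd, EE_even, DD_odd, DD_odd,
      DD_even, choose_pascal]
    have e1 : poch (-y - (m + 1 : ℕ) - 1) (k + 1) = (-y - m - 2) * poch (-y - m - 1) k := by
      rw [poch_succ_left, show -y - ((m + 1 : ℕ) : ℂ) - 1 = -y - m - 2 by push_cast; ring,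
        show -y - (m : ℂ) - 2 + 1 = -y - m - 1 by ring]
    have c1 := choose_rel m (2 * k)
    have a1 : poch (-y - m - 1) k ≠ 0 := poch_ne _ _ fun i hi => by
      have := hn (i + 1) (by omega)
      push_cast at this; intro h2; apply this; linear_combination h2
    have a2 : poch (1 + y) (k + 1) ≠ 0 := poch_ne _ _ fun i hi => h i (by omega)
    have a3 : (-y - m - 2 : ℂ) ≠ 0 := by
      have := hn 0 (by omega)
      push_cast at this; intro h2; apply this; linear_combination h2
    have a4 : (-y - m - 1 + k : ℂ) ≠ 0 := by
      have := hn (k + 1) (by omega)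
      push_cast at this; intro h2; apply this; linear_combination h2
    rw [e1]
    simp only [poch] at a2 ⊢
    generalize poch (-y - m - 1) k = P at *
    generalize poch (1 + y) k = Q at *
    generalize poch (x + 1) k = R at *
    generalize poch (-x) k = S at *
    have a5 := left_ne_zero_of_mul a2
    have a6 := right_ne_zero_of_mul a2
    push_cast at c1
    field_simp
    ring
  · rw [HH_odd, HH_even, EE_odd, EE_even, DD_odd, DD_even, DD_even,
      show 2 * (k + 1) = 2 * k + 1 + 1 by ring, choose_pascal]
    have e1 : poch (-y - (m + 1 : ℕ) - 1) (k + 1) = (-y - m - 2) * poch (-y - m - 1) k := by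
      rw [poch_succ_left, show -y - ((m + 1 : ℕ) : ℂ) - 1 = -y - m - 2 by push_cast; ring,
        show -y - (m : ℂ) - 2 + 1 = -y - m - 1 by ring]
    have c1 := choose_rel m (2 * k + 1)
    have a1 : poch (-y - m - 1) k ≠ 0 := poch_ne _ _ fun i hi => by
      have := hn (i + 1) (by omega)
      push_cast at this; intro h2; apply this; linear_combination h2
    have a2 : poch (1 + y) (k + 1) ≠ 0 := poch_ne _ _ fun i hi => h i (by omega)
    have a7 : 1 + y + ((k + 1 : ℕ) : ℂ) ≠ 0 := h (k + 1) (by omega)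
    have a3 : (-y - m - 2 : ℂ) ≠ 0 := by
      have := hn 0 (by omega)
      push_cast at this; intro h2; apply this; linear_combination h2
    have a4 : (-y - m - 1 + k : ℂ) ≠ 0 := by
      have := hn (k + 1) (by omega)
      push_cast at this; intro h2; apply this; linear_combination h2
    rw [e1]
    simp only [poch] at a2 ⊢
    generalize poch (-y - m - 1) k = P at *
    generalize poch (1 + y) k = Q at *
    generalize poch (x + 1) k = R at *
    generalize poch (-x) k = S at *
    have a5 := left_ne_zero_of_mul a2
    have a6 := right_ne_zero_of_mul a2
    push_cast at c1 a7 ⊢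
    field_simp
    linear_combination (-(y + m + 2) * (R * (x + 1 + k) * S * (-x + k))) * c1

theorem newton (x y : ℂ) (m : ℕ) (h : ∀ i : ℕ, i < m + 1 → 1 + y + (i : ℂ) ≠ 0) :
    poch (1 + y - x) m / poch (1 + y) (m + 1) =
      ∑ j ∈ Finset.range (m + 1), (m.choose j : ℂ) * EE x j / DD y m j := by
  induction m with
  | zero => simp [poch, EE, DD]
  | succ m ih =>
    have := ih fun i hi => h i (by omega)
    have t := tele m (fun j => (m.choose j : ℂ) * EE x j / DD y m j)
      (fun j => (y + m + 2) * (((m + 1).choose j : ℂ) * EE x j / DD y (m + 1) j))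
      (HH x y m) (m + 1 + y - x) (by simp) rfl (HH_last x y m)
      (fun j hj => step_one x y m h j hj)
    rw [← this, ← Finset.mul_sum] at t
    have a1 : (y + m + 2 : ℂ) ≠ 0 := by
      have := h (m + 1) (by omega)
      push_cast at this; intro h2; apply this; linear_combination h2
    apply mul_left_cancel₀ a1
    rw [← t, poch, poch]
    have a2 : poch (1 + y) (m + 1) ≠ 0 := poch_ne _ _ fun i hi => h i (by omega)
    have a3 : (1 + y + ((m + 1 : ℕ) : ℂ)) ≠ 0 := h (m + 1) (by omega)
    push_cast at a3 ⊢
    field_simp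
    ring

theorem step_two (x y b c : ℂ) (m : ℕ) (hy : y = c - b * (m + 1))
    (h : ∀ i : ℕ, i < m + 1 → 1 + y + (i : ℂ) ≠ 0) (j : ℕ)
    (hj : j < m + 2) :
    (c - x) * ((m.choose j : ℂ) * EE x j / DD y m j) =
      ((m + 1).choose j : ℂ) * (c + 1 + (j / 2 : ℕ) - j * b) * EE x j / DD y m j
        - HH x y m j + HH x y m (j + 1) := by
  have hn := ynz h
  rcases parity_cases j with rfl | ⟨k, rfl⟩ | ⟨k, rfl⟩
  · have := h 0 (by omega)
    simp [HH, EE, DD, poch] at this ⊢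
    field_simp
    ring
  · rw [show 2 * k + 1 + 1 = 2 * (k + 1) by ring, HH_odd, HH_even, EE_odd, EE_even, DD_odd,
      DD_even, choose_pascal, show (2 * k + 1) / 2 = k by omega]
    have c1 := choose_rel m (2 * k)
    have a1 : poch (-y - m - 1) k ≠ 0 := poch_ne _ _ fun i hi => by
      have := hn i (by omega)
      push_cast at this; intro h2; apply this; linear_combination h2
    have a2 : poch (1 + y) (k + 1) ≠ 0 := poch_ne _ _ fun i hi => h i (by omega)
    have a4 : (-y - m - 1 + k : ℂ) ≠ 0 := by
      have := hn k (by omega)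
      push_cast at this; intro h2; apply this; linear_combination h2
    simp only [poch] at a2 ⊢
    generalize poch (-y - m - 1) k = P at *
    generalize poch (1 + y) k = Q at *
    generalize poch (x + 1) k = R at *
    generalize poch (-x) k = S at *
    have a5 := left_ne_zero_of_mul a2
    have a6 := right_ne_zero_of_mul a2
    push_cast at c1 ⊢
    field_simp
    linear_combination (R * (x + 1 + k) * S) * ((b - 1) * c1 + (m.choose (2 * k) : ℂ) * hy)
  · rw [HH_odd, HH_even, EE_odd, EE_even, DD_odd, DD_even, show 2 * (k + 1) / 2 = k + 1 by omega,
      show 2 * (k + 1) = 2 * k + 1 + 1 by ring, choose_pascal]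
    have c1 := choose_rel m (2 * k + 1)
    have a1 : poch (-y - m - 1) k ≠ 0 := poch_ne _ _ fun i hi => by
      have := hn i (by omega)
      push_cast at this; intro h2; apply this; linear_combination h2
    have a2 : poch (1 + y) (k + 1) ≠ 0 := poch_ne _ _ fun i hi => h i (by omega)
    have a7 : 1 + y + ((k + 1 : ℕ) : ℂ) ≠ 0 := h (k + 1) (by omega)
    have a4 : (-y - m - 1 + k : ℂ) ≠ 0 := by
      have := hn k (by omega)
      push_cast at this; intro h2; apply this; linear_combination h2
    simp only [poch] at a2 ⊢
    generalize poch (-y - m - 1) k = P at *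
    generalize poch (1 + y) k = Q at *
    generalize poch (x + 1) k = R at *
    generalize poch (-x) k = S at *
    have a5 := left_ne_zero_of_mul a2
    have a6 := right_ne_zero_of_mul a2
    push_cast at c1 a7 ⊢
    field_simp
    linear_combination (R * (x + 1 + k) * S * (-x + k)) * (b * c1 + (m.choose (2 * k + 1) : ℂ) * hy)

theorem split_sum (n : ℕ) (f : ℕ → ℂ) : ∑ j ∈ Finset.range (n + 1), f j =
    ∑ k ∈ Finset.range (n / 2 + 1), f (2 * k) +
      ∑ k ∈ Finset.range ((n + 1) / 2), f (2 * k + 1) := by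
  induction n with
  | zero => simp
  | succ n ih =>
    rw [Finset.sum_range_succ, ih]
    rcases Nat.even_or_odd' n with ⟨k, rfl | rfl⟩
    · rw [show (2 * k + 1 + 1) / 2 = k + 1 by omega, show (2 * k + 1) / 2 = k by omega,
        show 2 * k / 2 = k by omega, Finset.sum_range_succ _ k, Finset.sum_range_succ _ k]
      ring
    · rw [show (2 * k + 1 + 1 + 1) / 2 = k + 1 by omega, show (2 * k + 1 + 1) / 2 = k + 1 by omega,
        show (2 * k + 1) / 2 = k by omega, Finset.sum_range_succ _ (k + 1)]
      rw [show 2 * (k + 1) = 2 * k + 1 + 1 by ring]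
      ring

/-- First-type reciprocal relation obtained from the Hagen–Rothe convolution identity
by duplicate inversion. -/
theorem hr_reciprocal_first (n : ℕ) (a b c : ℂ)
    (habn : a + (b - 1) * (n : ℂ) ≠ 0)
    (hcbn1 : ∀ j : ℕ, j < n → 1 + c - b * (n : ℂ) + (j : ℂ) ≠ 0)
    (hcbn2 : ∀ j : ℕ, j ≤ n / 2 → 1 + c - b * (n : ℂ) + (j : ℂ) ≠ 0)
    (hbnc : ∀ j : ℕ, j ≤ n / 2 → (b - 1) * (n : ℂ) - c + (j : ℂ) ≠ 0) :
    (a / (a + (b - 1) * (n : ℂ))) *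
        (poch (1 - a - b * (n : ℂ)) n / poch (1 + c - b * (n : ℂ)) n) =
      (∑ k ∈ Finset.range (n / 2 + 1),
        (n.choose (2 * k) : ℂ) *
          ((c + 1 + (k : ℂ) - 2 * b * (k : ℂ)) * poch (a + c + 1) k * poch (-a - c) k) /
          (poch ((b - 1) * (n : ℂ) - c) k * poch (1 + c - b * (n : ℂ)) (k + 1))) +
      ∑ k ∈ Finset.range ((n + 1) / 2),
        (n.choose (2 * k + 1) : ℂ) *
          ((c + 1 + (k : ℂ) - (2 * (k : ℂ) + 1) * b) * poch (a + c + 1) (k + 1) *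
            poch (-a - c) k) /
          (poch ((b - 1) * (n : ℂ) - c) (k + 1) * poch (1 + c - b * (n : ℂ)) (k + 1)) := by
  rcases n with _ | m
  · have := hcbn2 0 (by omega)
    simp [poch] at habn this ⊢
    field_simp
    ring
  · set y : ℂ := c - b * (m + 1) with hy
    have h : ∀ i : ℕ, i < m + 1 → 1 + y + (i : ℂ) ≠ 0 := fun i hi h0 => by
      apply hcbn1 i hi
      rw [← h0, hy]; push_cast; ring
    have t := tele m (fun j => (m.choose j : ℂ) * EE (a + c) j / DD y m j)
      (fun j => ((m + 1).choose j : ℂ) * (c + 1 + (j / 2 : ℕ) - j * b) * EE (a + c) j / DD y m j)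
      (HH (a + c) y m) (c - (a + c)) (by simp) rfl (HH_last _ y m)
      (fun j hj => step_two (a + c) y b c m hy h j hj)
    rw [← newton (a + c) y m h, split_sum] at t
    have e1 : (b - 1) * ((m + 1 : ℕ) : ℂ) - c = -y - m - 1 := by rw [hy]; push_cast; ring
    have e2 : 1 + c - b * ((m + 1 : ℕ) : ℂ) = 1 + y := by rw [hy]; push_cast; ring
    have e3 : 1 - a - b * ((m + 1 : ℕ) : ℂ) = 1 + y - (a + c) := by rw [hy]; push_cast; ring
    have e4 : -a - c = -(a + c) := by ring
    rw [e1, e2, e3, e4]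
    convert t using 1
    · have a2 : poch (1 + y) (m + 1) ≠ 0 := poch_ne _ _ h
      rw [poch]
      rw [show 1 + y - (a + c) + (m : ℂ) = -(a + (b - 1) * ((m + 1 : ℕ) : ℂ)) by
        rw [hy]; push_cast; ring]
      field_simp
      ring
    · congr 1
      · apply Finset.sum_congr rfl
        intro k _
        rw [EE_even, DD_even, show 2 * k / 2 = k by omega]
        push_cast
        ring
      · apply Finset.sum_congr rfl
        intro k _
        rw [EE_odd, DD_odd, show (2 * k + 1) / 2 = k by omega]
        push_cast
        ring
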